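/- arXiv:1905.00047 — 2 statements merged into one kernel-verified Lean document; each statement's English description precedes it below -/
import Mathlib

section
/- Let β_1,...,β_{n-1} be indeterminates, set M_k = (k-1)!·Σ_{i=1}^{n-1} β_i x_i^k, and let I ⊂ ℂ[β][x_1,...,x_n] be the ideal generated by symmetric polynomials in the x-variables with zero constant term. If nonnegative integers p_1, p_2, ... satisfy Σ_k k·p_k = C(n,2) and p_1 < C(n,2), then the product Π_k M_k^{p_k} lies in I. -/
open MvPolynomial Finset
open scoped Classical

/-- The polynomial ring `ℂ[β₁,…,βₙ][x₁,…,x_{n+1}]`, formalizing `ℂ[β][x]` for the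
symmetric group `S_{n+1}` with `n` parameters `β₁,…,βₙ`. -/
abbrev BetaXRing (n : ℕ) := MvPolynomial (Fin (n + 1)) (MvPolynomial (Fin n) ℂ)

/-- The element `M_k = (k-1)! · Σ_{i=1}^{n} βᵢ xᵢ^k` of `ℂ[β][x₁,…,x_{n+1}]`. -/
noncomputable def Mk (n k : ℕ) : BetaXRing n :=
  ((k - 1).factorial : BetaXRing n) *
    ∑ i : Fin n, C (X i) * X i.castSucc ^ k

/-- If the `a i` behave like Chern roots of a trivial bundle, then the elementary symmetric
polynomials in the `a i` with `i ∉ s` are homogeneous polynomials in the `a i` with `i ∈ s`. -/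
theorem coeff_prod_compl_mem_span_pow {A ι : Type*} [CommRing A] [Fintype ι] [DecidableEq ι]
    {a : ι → A} (h : ∏ i, (Polynomial.X + Polynomial.C (a i)) = Polynomial.X ^ Fintype.card ι)
    (s : Finset ι) :
    ∀ d i : ℕ, i + d + #s = Fintype.card ι →
      (∏ j ∈ sᶜ, (Polynomial.X + Polynomial.C (a j))).coeff i ∈ Submodule.span ℤ (a '' s) ^ d := by
  induction s using Finset.induction with
  | empty =>
    intro d i hd
    rw [compl_empty, h, Polynomial.coeff_X_pow]
    rcases d with _ | d
    · rw [if_pos (by simpa using hd), pow_zero]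
      exact Submodule.one_le.mp le_rfl
    · rw [if_neg (by simp at hd; omega)]
      exact zero_mem _
  | insert b s hb ih =>
    have hq : ∏ j ∈ sᶜ, (Polynomial.X + Polynomial.C (a j)) =
        (Polynomial.X + Polynomial.C (a b)) *
          ∏ j ∈ (insert b s)ᶜ, (Polynomial.X + Polynomial.C (a j)) := by
      rw [compl_insert, mul_prod_erase _ (fun j => Polynomial.X + Polynomial.C (a j))
        (by simpa using hb)]
    intro d
    induction d with
    | zero =>
      intro i hi
      have hcoeff : (∏ j ∈ (insert b s)ᶜ, (Polynomial.X + Polynomial.C (a j))).coeff i = 1 := by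
        have hc := card_compl (insert b s)
        rw [Finset.prod_X_add_C_coeff _ _ (by omega), show #(insert b s)ᶜ - i = 0 by omega]
        simp
      rw [hcoeff, pow_zero]
      exact Submodule.one_le.mp le_rfl
    | succ d ihd =>
      intro i hi
      have hS : Submodule.span ℤ (a '' s) ≤ Submodule.span ℤ (a '' ↑(insert b s)) :=
        Submodule.span_mono (Set.image_mono (by simp))
      have hb' : a b ∈ Submodule.span ℤ (a '' ↑(insert b s)) :=
        Submodule.subset_span ⟨b, by simp, rfl⟩
      have h₁ := ih (d + 1) (i + 1) (by rw [card_insert_of_notMem hb] at hi; omega)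
      have h₂ := ihd (i + 1) (by omega)
      rw [hq, add_mul, Polynomial.coeff_add, Polynomial.coeff_X_mul, Polynomial.coeff_C_mul] at h₁
      rw [← add_sub_cancel_right (Polynomial.coeff _ i) (a b * _)]
      refine sub_mem (pow_le_pow_left' hS _ h₁) ?_
      rw [pow_succ']
      exact Submodule.mul_mem_mul hb' h₂

theorem Submodule.pow_eq_bot_of_mul_eq_zero {A : Type*} [CommRing A] (S T : Submodule ℤ A) (b : A)
    (hT : ∀ u ∈ T, ∃ r : ℤ, ∃ v ∈ S, u = r • b + v) (L : ℕ)
    (h : ∀ c M : ℕ, L < M + c → ∀ y ∈ S ^ M, b ^ c * y = 0) {N : ℕ} (hN : L < N) :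
    T ^ N = ⊥ := by
  have key : ∀ N : ℕ, ∀ z ∈ T ^ N, ∀ c M : ℕ, L < M + c + N → ∀ y ∈ S ^ M,
      b ^ c * y * z = 0 := by
    intro N
    induction N with
    | zero =>
      intro z hz c M hL y hy
      rw [h c M (by omega) y hy, zero_mul]
    | succ N ih =>
      intro z hz c M hL y hy
      rw [pow_succ] at hz
      induction hz using Submodule.mul_induction_on' with
      | mem_mul_mem z' hz' u hu =>
        obtain ⟨r, v, hv, rfl⟩ := hT u hu
        have h₁ := ih z' hz' (c + 1) M (by omega) y hy
        have h₂ := ih z' hz' c (M + 1) (by omega) (y * v)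
          (by rw [pow_succ]; exact Submodule.mul_mem_mul hy hv)
        rw [zsmul_eq_mul]
        linear_combination (r : A) * h₁ + h₂
      | add x _ y' _ hx hy' => rw [mul_add, hx, hy', add_zero]
  refine (Submodule.eq_bot_iff _).2 fun z hz => ?_
  simpa using key N z hz 0 0 (by omega) 1 (by rw [pow_zero]; exact Submodule.one_le.mp le_rfl)

/-- Monomials in `k` of the roots vanish above degree `(m - 1) + ⋯ + (m - k)`. -/
theorem span_image_pow_eq_bot {A ι : Type*} [CommRing A] [Fintype ι] [DecidableEq ι]
    {a : ι → A} (h : ∏ i, (Polynomial.X + Polynomial.C (a i)) = Polynomial.X ^ Fintype.card ι)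
    (s : Finset ι) :
    ∀ N : ℕ, ∑ i ∈ range #s, (Fintype.card ι - 1 - i) < N →
      Submodule.span ℤ (a '' s) ^ N = ⊥ := by
  induction s using Finset.induction with
  | empty =>
    intro N hN
    obtain ⟨N, rfl⟩ : ∃ k, N = k + 1 := ⟨N - 1, by simp at hN; omega⟩
    simp [pow_succ]
  | insert b s hb ih =>
    intro N hN
    rw [card_insert_of_notMem hb, sum_range_succ] at hN
    have hcard : #s < Fintype.card ι :=
      (card_lt_univ_of_notMem hb)
    set q : Polynomial A := ∏ j ∈ sᶜ, (Polynomial.X + Polynomial.C (a j)) with hq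
    have hroot : q.eval (-a b) = 0 := by
      rw [hq, Polynomial.eval_prod]
      exact prod_eq_zero (i := b) (by simpa using hb) (by simp)
    obtain ⟨e, he⟩ : ∃ e, Fintype.card ι = e + 1 + #s :=
      ⟨Fintype.card ι - 1 - #s, by omega⟩
    have hdeg : q.natDegree ≤ e + 1 := by
      rw [hq]
      refine (Polynomial.natDegree_prod_le _ _).trans ?_
      refine (Finset.sum_le_card_nsmul _ _ 1 fun j _ => by compute_degree).trans ?_
      rw [card_compl]; simp; omega
    have hlead : q.coeff (e + 1) = 1 := by
      have hc := card_compl s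
      rw [hq, Finset.prod_X_add_C_coeff _ _ (by omega), show #sᶜ - (e + 1) = 0 by omega]
      simp
    have hrel : (-a b) ^ (e + 1) = -∑ i ∈ range (e + 1), q.coeff i * (-a b) ^ i := by
      rw [Polynomial.eval_eq_sum_range' (n := e + 2) (by omega), sum_range_succ, hlead,
        one_mul] at hroot
      exact eq_neg_of_add_eq_zero_right hroot
    refine Submodule.pow_eq_bot_of_mul_eq_zero (Submodule.span ℤ (a '' s)) _ (-a b) ?_ _ ?_ hN
    · intro u hu
      rw [coe_insert, Set.image_insert_eq, Submodule.mem_span_insert] at hu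
      obtain ⟨r, v, hv, rfl⟩ := hu
      exact ⟨-r, v, hv, by simp⟩
    · intro c
      induction c using Nat.strong_induction_on with
      | _ c ihc =>
        intro M hM y hy
        rcases Nat.lt_or_ge c (e + 1) with hc | hc
        · rw [ih M (by omega), Submodule.mem_bot] at hy
          rw [hy, mul_zero]
        · obtain ⟨c, rfl⟩ := Nat.exists_eq_add_of_le hc
          rw [pow_add, hrel, neg_mul, neg_mul, neg_eq_zero, sum_mul, sum_mul]
          refine sum_eq_zero fun i hi => ?_
          have hi' := mem_range.1 hi
          have h₁ := coeff_prod_compl_mem_span_pow h s (e + 1 - i) i (by omega)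
          have h₂ := ihc (i + c) (by omega) (e + 1 - i + M) (by omega) (q.coeff i * y)
            (by rw [pow_add]; exact Submodule.mul_mem_mul h₁ hy)
          rw [← h₂, pow_add]
          ring

theorem pow_add_pow_mem_pow {A : Type*} [CommRing A] {S : Submodule ℤ A} {x y : A}
    (hadd : x + y ∈ S) (hmul : x * y ∈ S ^ 2) :
    ∀ n : ℕ, x ^ n + y ^ n ∈ S ^ n
  | 0 => by
    rw [pow_zero, pow_zero, pow_zero]
    exact add_mem (Submodule.one_le.mp le_rfl) (Submodule.one_le.mp le_rfl)
  | 1 => by simpa using hadd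
  | n + 2 => by
    have h₁ : (x + y) * (x ^ (n + 1) + y ^ (n + 1)) ∈ S ^ (n + 2) := by
      rw [pow_succ' _ (n + 1)]
      exact Submodule.mul_mem_mul hadd (pow_add_pow_mem_pow hadd hmul (n + 1))
    have h₂ : (x * y) * (x ^ n + y ^ n) ∈ S ^ (n + 2) := by
      rw [add_comm n 2, pow_add]
      exact Submodule.mul_mem_mul hmul (pow_add_pow_mem_pow hadd hmul n)
    convert! sub_mem h₁ h₂ using 1
    ring

theorem pow_mul_pow_add_mem_pow {A : Type*} [CommRing A] {S : Submodule ℤ A} {x y : A}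
    (hadd : x + y ∈ S) (hmul : x * y ∈ S ^ 2) (p q : ℕ) :
    x ^ p * y ^ q + x ^ q * y ^ p ∈ S ^ (p + q) := by
  wlog hpq : p ≤ q generalizing p q
  · rw [add_comm (x ^ p * y ^ q), add_comm p q]
    exact this q p (by omega)
  obtain ⟨r, rfl⟩ := Nat.exists_eq_add_of_le hpq
  have h : (x * y) ^ p * (x ^ r + y ^ r) ∈ S ^ (p + (p + r)) := by
    rw [← add_assoc, ← two_mul, pow_add, pow_mul]
    exact Submodule.mul_mem_mul (Submodule.pow_mem_pow _ hmul p) (pow_add_pow_mem_pow hadd hmul r)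
  convert! h using 1
  ring

theorem sum_range_sub_two_lt_choose_two {m : ℕ} (hm : 2 ≤ m) :
    ∑ i ∈ range (m - 2), (m - 1 - i) < m.choose 2 := by
  obtain ⟨k, rfl⟩ := Nat.exists_eq_add_of_le' hm
  have h := sum_range_reflect (fun j => j) (k + 2)
  rw [sum_range_id, ← Nat.choose_two_right, sum_range_succ, sum_range_succ] at h
  simp only [Nat.add_sub_cancel]
  omega

/-- Transpositions act by `-1` on the top degree of the coinvariant algebra. -/
theorem prod_pow_add_prod_pow_swap {A ι : Type*} [CommRing A] [Fintype ι] [DecidableEq ι]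
    {a : ι → A} (h : ∏ i, (Polynomial.X + Polynomial.C (a i)) = Polynomial.X ^ Fintype.card ι)
    (e : ι → ℕ) (he : ∑ i, e i = (Fintype.card ι).choose 2) {i j : ι} (hij : i ≠ j) :
    ∏ l, a l ^ e l + ∏ l, a (Equiv.swap i j l) ^ e l = 0 := by
  set s : Finset ι := {i, j}ᶜ with hs
  have hsc : sᶜ = {i, j} := compl_compl _
  have hcard : #s + 2 = Fintype.card ι := by
    rw [← card_pair hij, hs, card_compl_add_card]
  set S := Submodule.span ℤ (a '' s)
  have hsplit : ∀ f : ι → A, ∏ l, f l = (∏ l ∈ s, f l) * (f i * f j) := fun f => by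
    rw [← prod_mul_prod_compl s f, hsc, prod_pair hij]
  have hsplit' : ∑ l ∈ s, e l + (e i + e j) = (Fintype.card ι).choose 2 := by
    rw [← he, ← sum_add_sum_compl s e, hsc, sum_pair hij]
  have hpoly : ∏ l ∈ sᶜ, (Polynomial.X + Polynomial.C (a l)) =
      Polynomial.X ^ 2 + Polynomial.C (a i + a j) * Polynomial.X + Polynomial.C (a i * a j) := by
    rw [hsc, prod_pair hij, Polynomial.C_add, Polynomial.C_mul]
    ring
  have hadd : a i + a j ∈ S := by
    have := coeff_prod_compl_mem_span_pow h s 1 1 (by omega)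
    rw [hpoly] at this
    simpa [Polynomial.coeff_X, Polynomial.coeff_C] using this
  have hmul : a i * a j ∈ S ^ 2 := by
    have := coeff_prod_compl_mem_span_pow h s 2 0 (by omega)
    rw [hpoly] at this
    simpa using this
  have hprod : ∏ l ∈ s, a l ^ e l ∈ S ^ ∑ l ∈ s, e l := by
    exact SetLike.prod_mem_graded (fun n => S ^ n) e (fun l => a l ^ e l) fun l hl =>
      Submodule.pow_mem_pow _ (Submodule.subset_span (Set.mem_image_of_mem a hl)) _
  have hswap : ∏ l ∈ s, a (Equiv.swap i j l) ^ e l = ∏ l ∈ s, a l ^ e l :=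
    prod_congr rfl fun l hl => by
      simp only [hs, mem_compl, mem_insert, mem_singleton, not_or] at hl
      rw [Equiv.swap_apply_of_ne_of_ne hl.1 hl.2]
  have hmem := Submodule.mul_mem_mul hprod (pow_mul_pow_add_mem_pow hadd hmul (e i) (e j))
  rw [← pow_add, hsplit', span_image_pow_eq_bot h s _ (by
    rw [show #s = Fintype.card ι - 2 by omega]
    exact sum_range_sub_two_lt_choose_two (by omega)), Submodule.mem_bot] at hmem
  rw [hsplit, hsplit, hswap, Equiv.swap_apply_left, Equiv.swap_apply_right, ← hmem]
  ring

theorem choose_two_card_le_sum {ι : Type*} [Fintype ι] {c : ι → ℕ} (hc : Function.Injective c) :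
    (Fintype.card ι).choose 2 ≤ ∑ i, c i := by
  have h := sum_range_le_sum (s := univ.map (⟨c, hc⟩ : ι ↪ ℕ) |>.map Nat.castEmbedding)
    (c := 0) (by simp)
  simp only [card_map, card_univ, zero_add, sum_map, Nat.castEmbedding_apply,
    Function.Embedding.coeFn_mk] at h
  rw [Nat.choose_two_right, ← sum_range_id]
  zify
  simpa using h

/-- A product of fewer than `m.choose 2` weighted power sums vanishes in the top degree of the
coinvariant algebra of `m` variables. -/
theorem prod_sum_mul_pow_eq_zero {A ι κ : Type*} [CommRing A] [Fintype ι]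
    [DecidableEq ι] [Fintype κ] [DecidableEq κ] {a : ι → A}
    (h2 : IsUnit (2 : A))
    (h : ∏ i, (Polynomial.X + Polynomial.C (a i)) = Polynomial.X ^ Fintype.card ι)
    (b : ι → A) (k : κ → ℕ)
    (hk : ∑ t, k t = (Fintype.card ι).choose 2) (hκ : Fintype.card κ < (Fintype.card ι).choose 2) :
    ∏ t, ∑ i, b i * a i ^ k t = 0 := by
  have hswap : ∀ c : ι → ℕ, ∃ s : Equiv.Perm ι, ∑ i, c i = Fintype.card κ →
      ∃ i j, i ≠ j ∧ c i = c j ∧ s = Equiv.swap i j := by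
    intro c
    by_cases hc : Function.Injective c
    · exact ⟨1, fun h => absurd (choose_two_card_le_sum hc) (by omega)⟩
    · rw [Function.not_injective_iff] at hc
      obtain ⟨i, j, hcij, hij⟩ := hc
      exact ⟨_, fun _ => ⟨i, j, hij, hcij, rfl⟩⟩
  choose s hs using hswap
  let c : (κ → ι) → ι → ℕ := fun f i => #{t | f t = i}
  have hc : ∀ f, ∑ i, c f i = Fintype.card κ := fun f =>
    (card_eq_sum_card_fiberwise fun _ _ => mem_univ _).symm
  have hsc : ∀ f, c (s (c f) ∘ f) = c f := by
    intro f
    obtain ⟨i, j, -, hcij, h_eq⟩ := hs (c f) (hc f)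
    funext l
    have h₁ : c (s (c f) ∘ f) l = c f (Equiv.swap i j l) := by
      simp only [c, h_eq, Function.comp_apply, Equiv.swap_apply_eq_iff]
    rw [h₁]
    by_cases hli : l = i
    · rw [hli, Equiv.swap_apply_left, hcij]
    by_cases hlj : l = j
    · rw [hlj, Equiv.swap_apply_right, hcij]
    · rw [Equiv.swap_apply_of_ne_of_ne hli hlj]
  have hb : ∀ f : κ → ι, ∏ t, b (f t) = ∏ i, b i ^ c f i := fun f => by
    rw [← Finset.prod_fiberwise' univ f b]
    simp only [prod_const, c]
  have ha : ∀ (f : κ → ι) (g : ι → A),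
      ∏ t, g (f t) ^ k t = ∏ i, g i ^ ∑ t with f t = i, k t := fun f g => by
    rw [← Finset.prod_fiberwise univ f]
    refine prod_congr rfl fun i _ => ?_
    rw [← prod_pow_eq_pow_sum]
    exact prod_congr rfl fun t ht => by rw [(mem_filter.1 ht).2]
  have hcancel : ∀ f : κ → ι, ∏ t, b (f t) * a (f t) ^ k t +
      ∏ t, b (s (c f) (f t)) * a (s (c f) (f t)) ^ k t = 0 := by
    intro f
    obtain ⟨i, j, hij, -, h_eq⟩ := hs (c f) (hc f)
    have h₁ := hb (s (c f) ∘ f)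
    simp only [hsc, Function.comp_apply] at h₁
    rw [prod_mul_distrib, prod_mul_distrib, h₁, ← hb, ha f a, ha f fun l => a (s (c f) l),
      ← mul_add, h_eq, prod_pow_add_prod_pow_swap h _ _ hij, mul_zero]
    rw [← hk, ← Finset.sum_fiberwise univ f k]
  rw [Fintype.prod_sum]
  refine sum_involution (fun f _ => s (c f) ∘ f) (fun f _ => hcancel f) ?_
    (fun _ _ => mem_univ _) ?_
  · intro f _ hf hfix
    have h₁ := hcancel f
    have h₂ : ∀ t, s (c f) (f t) = f t := congrFun hfix
    simp only [h₂, ← two_mul] at h₁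
    exact hf (h2.mul_right_eq_zero.1 h₁)
  · intro f _
    obtain ⟨i, j, -, -, h_eq⟩ := hs (c f) (hc f)
    funext t
    simp only [hsc]
    simp [h_eq]

theorem prod_X_add_C_mk_eq_X_pow {R ι : Type*} [CommRing R] [Fintype ι]
    {I : Ideal (MvPolynomial ι R)}
    (hI : ∀ d : ℕ, 0 < d → MvPolynomial.esymm ι R d ∈ I) :
    ∏ i, (Polynomial.X + Polynomial.C (Ideal.Quotient.mk I (MvPolynomial.X i))) =
      Polynomial.X ^ Fintype.card ι := by
  have hmap : ∏ i, (Polynomial.X + Polynomial.C (Ideal.Quotient.mk I (MvPolynomial.X i))) =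
      (∏ i : ι, (Polynomial.X + Polynomial.C (MvPolynomial.X i : MvPolynomial ι R))).map
        (Ideal.Quotient.mk I) := by
    simp [Polynomial.map_prod]
  rw [hmap, MvPolynomial.prod_C_add_X_eq_sum_esymm, Polynomial.map_sum,
    sum_eq_single_of_mem 0 (by simp)]
  · simp
  · intro d _ hd
    rw [Polynomial.map_mul, Polynomial.map_C,
      Ideal.Quotient.eq_zero_iff_mem.2 (hI d (Nat.pos_of_ne_zero hd)), Polynomial.C_0, zero_mul]

theorem MvPolynomial.constantCoeff_esymm {R ι : Type*} [CommRing R] [Fintype ι] {d : ℕ}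
    (hd : 0 < d) : constantCoeff (esymm ι R d) = 0 := by
  rw [esymm, map_sum]
  refine sum_eq_zero fun t ht => ?_
  rw [map_prod]
  obtain ⟨i, hi⟩ := card_pos.1 ((mem_powersetCard.1 ht).2.symm ▸ hd)
  exact prod_eq_zero hi (by rw [constantCoeff_X])

theorem sum_lt_of_sum_mul_eq {N D : ℕ} {p : ℕ → ℕ} (hsum : ∑ k ∈ Icc 1 N, k * p k = D)
    (hp1 : p 1 < D) : ∑ k ∈ Icc 1 N, p k < D := by
  have hle : ∀ k ∈ Icc 1 N, p k ≤ k * p k := fun k hk =>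
    Nat.le_mul_of_pos_left _ (mem_Icc.1 hk).1
  by_contra! hge
  have heq := (sum_eq_sum_iff_of_le hle).1 (le_antisymm (sum_le_sum hle) (hsum ▸ hge))
  have hzero : ∀ k ∈ Icc 1 N, k ≠ 1 → k * p k = 0 := by
    intro k hk hk1
    have h₁ := heq k hk
    have h₂ := (mem_Icc.1 hk).1
    rcases Nat.eq_zero_or_pos (p k) with h | h
    · simp [h]
    · nlinarith [show 2 ≤ k by omega]
  rcases Nat.eq_zero_or_pos N with hN | hN
  · subst hN
    simp at hsum
    omega
  · rw [sum_eq_single_of_mem 1 (by simp; omega) hzero] at hsum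
    omega

theorem prod_pow_eq_zero_of_eq_mul {A ι : Type*} [CommRing A] {f g h : ι → A} {s : Finset ι}
    {p : ι → ℕ} (hf : ∀ k, f k = g k * h k) (hh : ∏ k ∈ s, h k ^ p k = 0) :
    ∏ k ∈ s, f k ^ p k = 0 := by
  simp only [hf, mul_pow]
  rw [prod_mul_distrib, hh, mul_zero]

/-- If `Σₖ k·pₖ = C(n+1, 2)` and `p₁ < C(n+1, 2)`, then `Πₖ Mₖ^{pₖ}` lies in the
ideal generated by the symmetric polynomials in the `x` variables with zero constant
term. -/
theorem prod_Mk_mem_coinvIdeal (n N : ℕ) (p : ℕ → ℕ)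
    (hsum : ∑ k ∈ Finset.Icc 1 N, k * p k = (n + 1).choose 2)
    (hp1 : p 1 < (n + 1).choose 2) :
    (∏ k ∈ Finset.Icc 1 N, Mk n k ^ p k) ∈
      Ideal.span {q : BetaXRing n | q.IsSymmetric ∧ constantCoeff q = 0} := by
  set I : Ideal (BetaXRing n) :=
    Ideal.span {q : BetaXRing n | q.IsSymmetric ∧ constantCoeff q = 0}
  let π := Ideal.Quotient.mk I
  have h2 : IsUnit (2 : BetaXRing n ⧸ I) := by
    simpa only [map_ofNat] using
      (IsUnit.mk0 (2 : ℂ) two_ne_zero).map (π.comp (C.comp C))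
  have hroots := prod_X_add_C_mk_eq_X_pow (I := I) fun d hd =>
    Ideal.subset_span ⟨esymm_isSymmetric _ _ d, constantCoeff_esymm hd⟩
  let b : Fin (n + 1) → BetaXRing n ⧸ I := Fin.snoc (fun i => π (C (X i))) 0
  have hMk : ∀ k, π (Mk n k) = π ((k - 1).factorial : BetaXRing n) *
      ∑ i, b i * π (X i) ^ k := by
    intro k
    rw [Mk, map_mul, map_sum, Fin.sum_univ_castSucc]
    simp [b]
  have hvanish := prod_sum_mul_pow_eq_zero h2 hroots b
    (κ := (k : Icc 1 N) × Fin (p k)) (fun t => t.1)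
    (by
      rw [Fintype.sum_sigma, Fintype.card_fin, ← hsum, ← sum_coe_sort _ fun k => k * p k]
      simp [mul_comm])
    (by
      rw [Fintype.card_sigma, Fintype.card_fin]
      simp only [Fintype.card_fin]
      rw [sum_coe_sort _ p]
      exact sum_lt_of_sum_mul_eq hsum hp1)
  rw [Fintype.prod_sigma] at hvanish
  simp only [prod_const, card_univ, Fintype.card_fin] at hvanish
  rw [prod_coe_sort _ fun k => (∑ i, b i * π (X i) ^ k) ^ p k] at hvanish
  rw [← Ideal.Quotient.eq_zero_iff_mem, map_prod]
  simp only [map_pow]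
  change ∏ k ∈ Icc 1 N, π (Mk n k) ^ p k = 0
  exact prod_pow_eq_zero_of_eq_mul hMk hvanish
end

section
/- For every w ∈ S_n: Σ_{u: w⋖u} 𝔖_u(1,...,1)·(b_{w⋖u} − c_{w⋖u}) = 0, where the sum is over strong Bruhat covers u of w, and for a cover w ⋖ w·t_{ij} (i<j), b = #{k : i<k<j, w(k) > w(j)} and c = #{k > j : w(i) < w(k) < w(j)}. -/
open Equiv Finset
open scoped Classical

/-- Number of inversions (Coxeter length) of a permutation of `Fin n`. -/
def invCount {n : ℕ} (v : Equiv.Perm (Fin n)) : ℕ :=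
  (Finset.univ.filter (fun p : Fin n × Fin n => p.1 < p.2 ∧ v p.2 < v p.1)).card

/-- `a` statistic of a (candidate) cover `v ⋖ v·t_{ij}`. -/
def aQ {n : ℕ} (v : Equiv.Perm (Fin n)) (i j : Fin n) : ℕ :=
  (Finset.univ.filter (fun k : Fin n => k < i ∧ v i < v k ∧ v k < v j)).card

/-- `b` statistic. -/
def bQ {n : ℕ} (v : Equiv.Perm (Fin n)) (i j : Fin n) : ℕ :=
  (Finset.univ.filter (fun k : Fin n => i < k ∧ k < j ∧ v j < v k)).card

/-- `c` statistic. -/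
def cQ {n : ℕ} (v : Equiv.Perm (Fin n)) (i j : Fin n) : ℕ :=
  (Finset.univ.filter (fun k : Fin n => j < k ∧ v i < v k ∧ v k < v j)).card

/-- `d` statistic. -/
def dQ {n : ℕ} (v : Equiv.Perm (Fin n)) (i j : Fin n) : ℕ :=
  (Finset.univ.filter (fun k : Fin n => i < k ∧ k < j ∧ v k < v i)).card

/-- Covering relation in strong Bruhat order. -/
def BruhatCov {n : ℕ} (v w : Equiv.Perm (Fin n)) : Prop :=
  ∃ i j : Fin n, i < j ∧ w = v * Equiv.swap i j ∧ invCount w = invCount v + 1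

/-- The adjacent transposition `s_{a+1} = (a+1, a+2)` of `Fin (n+1)` (0-indexed positions `a, a+1`),
for `a : Fin n`. -/
def adjTransp {n : ℕ} (a : Fin n) : Equiv.Perm (Fin (n + 1)) :=
  Equiv.swap a.castSucc a.succ

/-- Principal specialization `𝔖_u(1,...,1)` of the Schubert polynomial, defined via
Macdonald's reduced word identity:
`𝔖_u(1,…,1) = (1/ℓ(u)!) ∑_{reduced words (a_1,…,a_ℓ) of u} a_1 ⋯ a_ℓ`. -/
noncomputable def prinSpec {n : ℕ} (u : Equiv.Perm (Fin (n + 1))) : ℚ :=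
  (∑ a ∈ Finset.univ.filter
      (fun a : Fin (invCount u) → Fin n =>
        (List.ofFn (fun i => adjTransp (a i))).prod = u),
    ∏ i, ((a i : ℕ) + 1 : ℚ)) / (invCount u).factorial

section BruhatCoverSum

variable {n : ℕ}

lemma apply_perm_inv {α : Type*} (w : Perm α) (a : α) : w (w⁻¹ a) = a :=
  w.apply_symm_apply a

lemma adjTransp_mul_self (k : Fin n) : adjTransp k * adjTransp k = 1 := by
  simp [adjTransp]

lemma adjTransp_mul_cancel (k : Fin n) (w : Perm (Fin (n + 1))) :
    adjTransp k * (adjTransp k * w) = w := by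
  rw [← mul_assoc, adjTransp_mul_self, one_mul]

lemma adjTransp_inv (k : Fin n) : (adjTransp k)⁻¹ = adjTransp k := by
  simp [adjTransp]

lemma adjTransp_castSucc (k : Fin n) : adjTransp k k.castSucc = k.succ := by
  simp [adjTransp]

lemma adjTransp_succ (k : Fin n) : adjTransp k k.succ = k.castSucc := by
  simp [adjTransp]

/-- An adjacent transposition preserves the order of every pair other than the one it swaps. -/
lemma adjTransp_lt {k : Fin n} {a b : Fin (n + 1)} (hab : a < b)
    (hne : ¬ (a = k.castSucc ∧ b = k.succ)) : adjTransp k a < adjTransp k b := by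
  unfold adjTransp
  rw [swap_apply_def, swap_apply_def]
  simp only [Fin.ext_iff, Fin.lt_def, Fin.val_castSucc, Fin.val_succ] at *
  split_ifs <;> (try simp only [Fin.val_castSucc, Fin.val_succ]) <;> omega

lemma adjTransp_lt_iff {k : Fin n} {a b : Fin (n + 1)}
    (h₁ : ¬ (a = k.castSucc ∧ b = k.succ)) (h₂ : ¬ (a = k.succ ∧ b = k.castSucc)) :
    adjTransp k a < adjTransp k b ↔ a < b := by
  refine ⟨fun h => ?_, fun h => adjTransp_lt h h₁⟩
  by_contra hba
  rcases eq_or_lt_of_le (not_lt.mp hba) with e | h'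
  · exact absurd (e ▸ h) (lt_irrefl _)
  · exact lt_asymm h (adjTransp_lt h' fun h => h₂ ⟨h.2, h.1⟩)

lemma adjTransp_mul_eq_mul_swap {k : Fin n} {w : Perm (Fin (n + 1))} {i j : Fin (n + 1)}
    (h : (w i = k.castSucc ∧ w j = k.succ) ∨ (w i = k.succ ∧ w j = k.castSucc)) :
    adjTransp k * w = w * swap i j := by
  have : adjTransp k = swap (w i) (w j) := by
    rcases h with ⟨h₁, h₂⟩ | ⟨h₁, h₂⟩
    · rw [h₁, h₂, adjTransp]
    · rw [h₁, h₂, adjTransp, swap_comm]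
  rw [this, swap_apply_apply, inv_mul_cancel_right]

/-- `k` is a left descent of `w`: the value `k + 1` stands before the value `k`. -/
def LeftDescent (k : Fin n) (w : Perm (Fin (n + 1))) : Prop := w⁻¹ k.succ < w⁻¹ k.castSucc

lemma leftDescent_adjTransp_mul {k : Fin n} {w : Perm (Fin (n + 1))} :
    LeftDescent k (adjTransp k * w) ↔ ¬ LeftDescent k w := by
  have : w⁻¹ k.castSucc ≠ w⁻¹ k.succ := by
    simp [Fin.ext_iff]
  simp only [LeftDescent, mul_inv_rev, adjTransp_inv, Perm.mul_apply, adjTransp_succ,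
    adjTransp_castSucc, not_lt]
  exact ⟨le_of_lt, fun h => lt_of_le_of_ne h this⟩

lemma invCount_adjTransp_mul {k : Fin n} {w : Perm (Fin (n + 1))} (h : ¬ LeftDescent k w) :
    invCount (adjTransp k * w) = invCount w + 1 := by
  have hne : w⁻¹ k.castSucc ≠ w⁻¹ k.succ := by simp [Fin.ext_iff]
  have hlt : w⁻¹ k.castSucc < w⁻¹ k.succ := lt_of_le_of_ne (not_lt.mp h) hne
  have hkne : k.castSucc ≠ k.succ := by simp [Fin.ext_iff]
  unfold invCount
  rw [← Finset.card_insert_of_notMem (a := (w⁻¹ k.castSucc, w⁻¹ k.succ))]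
  · congr 1
    ext ⟨x, y⟩
    simp only [mem_filter, mem_univ, true_and, mem_insert, Prod.mk.injEq, Perm.eq_inv_iff_eq]
    rw [Perm.mul_apply, Perm.mul_apply]
    by_cases h₁ : w y = k.castSucc ∧ w x = k.succ
    · have hx : x = w⁻¹ k.succ := by rw [← h₁.2]; simp
      have hy : y = w⁻¹ k.castSucc := by rw [← h₁.1]; simp
      have : ¬ x < y := by rw [hx, hy]; exact not_lt.mpr hlt.le
      simp [this, h₁, hkne.symm]
    · by_cases h₂ : w y = k.succ ∧ w x = k.castSucc
      · have hx : x = w⁻¹ k.castSucc := by rw [← h₂.2]; simp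
        have hy : y = w⁻¹ k.succ := by rw [← h₂.1]; simp
        have : x < y := by rw [hx, hy]; exact hlt
        simp [this, h₂, adjTransp_castSucc, adjTransp_succ]
      · rw [adjTransp_lt_iff h₁ h₂]
        tauto
  · simp [Fin.le_def]

lemma invCount_eq_adjTransp_mul_add_one {k : Fin n} {w : Perm (Fin (n + 1))}
    (h : LeftDescent k w) : invCount w = invCount (adjTransp k * w) + 1 := by
  rw [← invCount_adjTransp_mul (k := k) (by rwa [leftDescent_adjTransp_mul, not_not]),
    adjTransp_mul_cancel]

/-- Swapping the entries in positions `i < j` with `v i < v j` increases the length. -/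
lemma invCount_lt_invCount_mul_swap {v : Perm (Fin n)} {i j : Fin n} (hij : i < j)
    (h : v i < v j) : invCount v < invCount (v * swap i j) := by
  unfold invCount
  set t := swap i j with ht
  have hmem : (i, j) ∈ univ.filter
      (fun p : Fin n × Fin n => p.1 < p.2 ∧ (v * t) p.2 < (v * t) p.1) := by
    simp [ht, hij, h]
  rw [← Finset.card_erase_add_one hmem, Nat.lt_succ_iff]
  have htt : ∀ x, t (t x) = x := by simp [ht]
  refine Finset.card_le_card_of_injOn
    (fun p => if t p.1 < t p.2 then (t p.1, t p.2) else p) ?_ ?_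
  · rintro ⟨x, y⟩ hp
    simp only [coe_filter, mem_univ, true_and, Set.mem_ofPred_eq] at hp
    obtain ⟨hxy, hv⟩ := hp
    simp only [coe_erase, coe_filter, mem_univ, true_and, Set.mem_sdiff, Set.mem_ofPred_eq,
      Set.mem_singleton_iff]
    split_ifs with hlt
    · refine ⟨⟨hlt, by simpa [htt] using hv⟩, ?_⟩
      intro e
      simp only [Prod.mk.injEq] at e
      have hx : x = j := by rw [← htt x, e.1]; simp [ht]
      have hy : y = i := by rw [← htt y, e.2]; simp [ht]
      subst hx hy
      exact lt_asymm hxy hij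
    · have hnij : ¬ (x = i ∧ y = j) := by
        rintro ⟨rfl, rfl⟩
        exact lt_asymm hv h
      refine ⟨⟨hxy, ?_⟩, by simpa using hnij⟩
      simp only [ht, Perm.mul_apply, swap_apply_def] at hlt ⊢
      grind
  · rintro ⟨x, y⟩ hp ⟨x', y'⟩ hp' e
    simp only [coe_filter, mem_univ, true_and, Set.mem_ofPred_eq] at hp hp'
    have := htt x
    have := htt y
    have := htt x'
    have := htt y'
    dsimp only at e
    grind

lemma lt_of_invCount_lt_mul_swap {v : Perm (Fin n)} {i j : Fin n} (hij : i < j)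
    (h : invCount v < invCount (v * swap i j)) : v i < v j := by
  by_contra hle
  have hlt : v j < v i := lt_of_le_of_ne (not_lt.mp hle) (by simpa using hij.ne')
  have := invCount_lt_invCount_mul_swap (v := v * swap i j) hij (by simpa using hlt)
  rw [mul_swap_mul_self] at this
  omega

lemma invCount_inv (v : Perm (Fin n)) : invCount v⁻¹ = invCount v := by
  unfold invCount
  refine Finset.card_bij' (fun p _ => (v⁻¹ p.2, v⁻¹ p.1)) (fun p _ => (v p.2, v p.1)) ?_ ?_ ?_ ?_
    <;> simp +contextual

/-- The weighted count of words of length `L` in the adjacent transpositions with product `u`. -/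
noncomputable def wordSum (L : ℕ) (u : Perm (Fin (n + 1))) : ℚ :=
  ∑ a ∈ univ.filter (fun a : Fin L → Fin n => (List.ofFn (fun i => adjTransp (a i))).prod = u),
    ∏ i, ((a i : ℕ) + 1 : ℚ)

lemma prinSpec_eq_wordSum (u : Perm (Fin (n + 1))) :
    prinSpec u = wordSum (invCount u) u / (invCount u).factorial := rfl

lemma wordSum_succ (L : ℕ) (u : Perm (Fin (n + 1))) :
    wordSum (L + 1) u = ∑ k : Fin n, ((k : ℕ) + 1 : ℚ) * wordSum L (adjTransp k * u) := by
  simp only [wordSum, Finset.sum_filter, Finset.mul_sum]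
  rw [← (Fin.consEquiv fun _ : Fin (L + 1) => Fin n).sum_comp, Fintype.sum_prod_type]
  refine Finset.sum_congr rfl fun k _ => Finset.sum_congr rfl fun a _ => ?_
  have : (adjTransp k * (List.ofFn fun i => adjTransp (a i)).prod = u) ↔
      (List.ofFn fun i => adjTransp (a i)).prod = adjTransp k * u := by
    rw [← eq_inv_mul_iff_mul_eq, adjTransp_inv]
  simp [Fin.consEquiv, List.ofFn_succ, Fin.prod_univ_succ, this]

lemma invCount_one : invCount (1 : Perm (Fin n)) = 0 := by
  simp only [invCount, Finset.card_eq_zero, Finset.filter_eq_empty_iff]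
  rintro p - ⟨h₁, h₂⟩
  exact lt_asymm h₁ h₂

lemma wordSum_eq_zero {L : ℕ} {u : Perm (Fin (n + 1))} (h : L < invCount u) :
    wordSum L u = 0 := by
  induction L generalizing u with
  | zero =>
    have : (1 : Perm (Fin (n + 1))) ≠ u := by
      rintro rfl
      simp [invCount_one] at h
    simp [wordSum, this]
  | succ L ih =>
    rw [wordSum_succ]
    refine Finset.sum_eq_zero fun k _ => ?_
    rw [ih, mul_zero]
    by_cases hk : LeftDescent k u
    · have := invCount_eq_adjTransp_mul_add_one hk
      omega
    · have := invCount_adjTransp_mul hk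
      omega

lemma wordSum_inv (L : ℕ) (u : Perm (Fin (n + 1))) : wordSum L u⁻¹ = wordSum L u := by
  simp only [wordSum, Finset.sum_filter]
  rw [← (Equiv.arrowCongr (Fin.revPerm (n := L)) (Equiv.refl (Fin n))).sum_comp]
  refine Finset.sum_congr rfl fun a _ => ?_
  have h₁ : (List.ofFn fun i => adjTransp
      (Equiv.arrowCongr (Fin.revPerm (n := L)) (Equiv.refl (Fin n)) a i)).prod =
      (List.ofFn fun i => adjTransp (a i)).prod⁻¹ := by
    rw [List.prod_inv_reverse, List.map_ofFn]
    congr 1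
    refine List.ext_getElem (by simp) fun m h₁ h₂ => ?_
    simp [adjTransp_inv, Fin.rev, Nat.sub_sub, Nat.add_comm]
  have h₂ : ∏ i, (((Equiv.arrowCongr (Fin.revPerm (n := L)) (Equiv.refl (Fin n)) a i : Fin n) : ℕ)
      + 1 : ℚ) = ∏ i, ((a i : ℕ) + 1 : ℚ) := by
    rw [← Equiv.prod_comp (Fin.revPerm (n := L))]
    simp
  rw [h₁, h₂]
  simp only [inv_inj]

lemma prinSpec_inv (u : Perm (Fin (n + 1))) : prinSpec u⁻¹ = prinSpec u := by
  rw [prinSpec_eq_wordSum, prinSpec_eq_wordSum, invCount_inv, wordSum_inv]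

lemma invCount_mul_prinSpec (u : Perm (Fin (n + 1))) :
    (invCount u : ℚ) * prinSpec u =
      ∑ k : Fin n, if LeftDescent k u then ((k : ℕ) + 1 : ℚ) * prinSpec (adjTransp k * u) else 0 := by
  rcases h : invCount u with _ | L
  · rw [Finset.sum_eq_zero]
    · simp
    · intro k _
      rw [if_neg]
      intro hk
      have := invCount_eq_adjTransp_mul_add_one hk
      omega
  · rw [prinSpec_eq_wordSum, h, wordSum_succ, Nat.factorial_succ, Finset.sum_div, Finset.mul_sum]
    refine Finset.sum_congr rfl fun k _ => ?_
    split_ifs with hk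
    · have := invCount_eq_adjTransp_mul_add_one hk
      have hL : invCount (adjTransp k * u) = L := by omega
      rw [prinSpec_eq_wordSum, hL]
      have := L.factorial_ne_zero
      push_cast
      field_simp
    · have := invCount_adjTransp_mul hk
      rw [wordSum_eq_zero (by omega)]
      simp

/-- The number of larger entries to the left of position `y`. -/
def leftInv (w : Perm (Fin n)) (y : Fin n) : ℕ :=
  (univ.filter fun x : Fin n => x < y ∧ w y < w x).card

lemma sum_leftInv (w : Perm (Fin n)) : ∑ y, leftInv w y = invCount w := by
  unfold leftInv invCount
  simp only [Finset.card_filter]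
  rw [Fintype.sum_prod_type, Finset.sum_comm]

lemma sum_mul_sub_eq (L : Fin (n + 1) → ℚ) :
    ∑ k : Fin n, ((k : ℕ) + 1 : ℚ) * (L k.succ - L k.castSucc) =
      (n + 1) * L (Fin.last n) - ∑ v, L v := by
  induction n with
  | zero => simp
  | succ n ih =>
    have := ih fun v => L v.castSucc
    rw [Fin.sum_univ_castSucc, Fin.sum_univ_castSucc (n := n + 1)]
    simp only [Fin.val_castSucc, Fin.succ_castSucc, Fin.val_last, Fin.succ_last] at this ⊢
    rw [this]
    push_cast
    ring

/-- The pair of positions `p = (i, j)` with `i < j` indexes a strong Bruhat cover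
`w ⋖ w * swap i j`. -/
def IsCoverPair (w : Perm (Fin n)) (p : Fin n × Fin n) : Prop :=
  p.1 < p.2 ∧ invCount (w * swap p.1 p.2) = invCount w + 1

lemma isCoverPair_and_leftDescent_iff {k : Fin n} {w : Perm (Fin (n + 1))} {i j : Fin (n + 1)}
    (h₁ : ¬ (w i = k.castSucc ∧ w j = k.succ)) (h₂ : ¬ (w i = k.succ ∧ w j = k.castSucc)) :
    (IsCoverPair w (i, j) ∧ LeftDescent k (w * swap i j)) ↔
      (LeftDescent k w ∧ IsCoverPair (adjTransp k * w) (i, j)) := by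
  simp only [IsCoverPair, mul_assoc]
  constructor
  · rintro ⟨⟨hij, hw⟩, hk⟩
    have e₁ := invCount_eq_adjTransp_mul_add_one hk
    have hkw : LeftDescent k w := by
      by_contra hkw
      have e₂ := invCount_adjTransp_mul hkw
      have hlt := lt_of_invCount_lt_mul_swap hij (by omega : invCount w < invCount (w * swap i j))
      have := invCount_lt_invCount_mul_swap (v := adjTransp k * w) hij (adjTransp_lt hlt h₁)
      rw [mul_assoc] at this
      omega
    have e₂ := invCount_eq_adjTransp_mul_add_one hkw
    exact ⟨hkw, hij, by omega⟩
  · rintro ⟨hkw, hij, hw⟩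
    have e₂ := invCount_eq_adjTransp_mul_add_one hkw
    have hlt : w i < w j := by
      rw [← adjTransp_lt_iff h₁ h₂]
      refine lt_of_invCount_lt_mul_swap (v := adjTransp k * w) hij ?_
      rw [mul_assoc]
      omega
    have := invCount_lt_invCount_mul_swap hij hlt
    have hk : LeftDescent k (w * swap i j) := by
      by_contra hk
      have := invCount_adjTransp_mul hk
      omega
    have := invCount_eq_adjTransp_mul_add_one hk
    exact ⟨⟨hij, by omega⟩, hk⟩

lemma LeftDescent.lt_of_apply {k : Fin n} {w : Perm (Fin (n + 1))} (h : LeftDescent k w)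
    {x y : Fin (n + 1)} (hx : w x = k.succ) (hy : w y = k.castSucc) : x < y := by
  rw [LeftDescent, ← hx, ← hy] at h
  simpa using h

lemma bQ_adjTransp_mul {k : Fin n} {w : Perm (Fin (n + 1))} {i j : Fin (n + 1)}
    (hk : LeftDescent k w) (hk' : LeftDescent k (w * swap i j)) :
    bQ (adjTransp k * w) i j = bQ w i j := by
  unfold bQ
  congr 1
  ext x
  simp only [mem_filter, mem_univ, true_and]
  refine and_congr_right fun hix => and_congr_right fun hxj => ?_
  rw [Perm.mul_apply, Perm.mul_apply]
  apply adjTransp_lt_iff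
  · rintro ⟨hj, hx⟩
    have : x < i := hk'.lt_of_apply
      (by rw [Perm.mul_apply, swap_apply_of_ne_of_ne hix.ne' hxj.ne, hx]) (by simp [hj])
    exact lt_asymm this hix
  · rintro ⟨hj, hx⟩
    exact lt_asymm (hk.lt_of_apply hj hx) hxj

lemma castSucc_lt_iff_succ_lt_or_eq {k : Fin n} {a : Fin (n + 1)} :
    k.castSucc < a ↔ k.succ < a ∨ a = k.succ := by
  simp only [Fin.lt_def, Fin.ext_iff, Fin.val_castSucc, Fin.val_succ]
  omega

lemma leftInv_succ_eq_add_bQ {k : Fin n} {w : Perm (Fin (n + 1))} (h : ¬ LeftDescent k w) :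
    leftInv w (w⁻¹ k.succ) =
      leftInv w (w⁻¹ k.castSucc) + bQ w (w⁻¹ k.castSucc) (w⁻¹ k.succ) := by
  have hne : w⁻¹ k.castSucc ≠ w⁻¹ k.succ := by simp [Fin.ext_iff]
  have hlt : w⁻¹ k.castSucc < w⁻¹ k.succ := lt_of_le_of_ne (not_lt.mp h) hne
  unfold leftInv bQ
  rw [← Finset.card_union_of_disjoint]
  · congr 1
    ext x
    simp only [mem_filter, mem_univ, true_and, mem_union]
    rw [apply_perm_inv, apply_perm_inv]
    have h₁ := castSucc_lt_iff_succ_lt_or_eq (k := k) (a := w x)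
    have h₂ : w x = k.succ ↔ x = w⁻¹ k.succ := Perm.eq_inv_iff_eq.symm
    have h₃ : k.succ < w x → x ≠ w⁻¹ k.castSucc := by
      rintro h rfl
      rw [apply_perm_inv] at h
      exact lt_asymm h Fin.castSucc_lt_succ
    grind
  · rw [Finset.disjoint_left]
    intro x
    simp only [mem_filter, mem_univ, true_and]
    rintro ⟨h, -⟩ ⟨h', -⟩
    exact lt_asymm h h'

lemma leftInv_castSucc_eq_add_bQ {k : Fin n} {w : Perm (Fin (n + 1))} (h : LeftDescent k w) :
    leftInv w (w⁻¹ k.castSucc) = leftInv w (w⁻¹ k.succ) + 1 +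
      bQ (adjTransp k * w) (w⁻¹ k.succ) (w⁻¹ k.castSucc) := by
  have hlt : w⁻¹ k.succ < w⁻¹ k.castSucc := h
  have hmem : w⁻¹ k.succ ∈ univ.filter
      (fun x => x < w⁻¹ k.castSucc ∧ w (w⁻¹ k.castSucc) < w x) := by
    simpa using hlt
  have hne : k.castSucc ≠ k.succ := by simp [Fin.ext_iff]
  unfold leftInv bQ
  rw [← Finset.card_erase_add_one hmem, add_right_comm, ← Finset.card_union_of_disjoint]
  · congr 2
    ext x
    simp only [mem_filter, mem_univ, true_and, mem_union, mem_erase]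
    rw [Perm.mul_apply, Perm.mul_apply, apply_perm_inv, apply_perm_inv, adjTransp_castSucc]
    have h₁ := castSucc_lt_iff_succ_lt_or_eq (k := k) (a := w x)
    have h₂ : w x = k.succ ↔ x = w⁻¹ k.succ := Perm.eq_inv_iff_eq.symm
    by_cases hx : w x = k.succ
    · grind
    by_cases hx' : w x = k.castSucc
    · have : x = w⁻¹ k.castSucc := Perm.eq_inv_iff_eq.mpr hx'
      grind
    · rw [adjTransp, swap_apply_of_ne_of_ne hx' hx]
      grind
  · rw [Finset.disjoint_left]
    intro x
    simp only [mem_filter, mem_univ, true_and]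
    rintro ⟨h, -⟩ ⟨h', -⟩
    exact lt_asymm h h'

/-- Lowering after raising minus raising after lowering is diagonal, one left descent at a time. -/
lemma sum_cover_sub_cover (k : Fin n) (w : Perm (Fin (n + 1))) (f : Perm (Fin (n + 1)) → ℚ) :
    (∑ p, ((if IsCoverPair w p ∧ LeftDescent k (w * swap p.1 p.2) then
          (1 + 2 * bQ w p.1 p.2 : ℚ) * f (adjTransp k * (w * swap p.1 p.2)) else 0) -
        (if LeftDescent k w ∧ IsCoverPair (adjTransp k * w) p then
          (1 + 2 * bQ (adjTransp k * w) p.1 p.2 : ℚ) * f (adjTransp k * w * swap p.1 p.2) else 0))) =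
      (1 + 2 * ((leftInv w (w⁻¹ k.succ) : ℚ) - leftInv w (w⁻¹ k.castSucc))) * f w := by
  have hgen : ∀ p : Fin (n + 1) × Fin (n + 1),
      ¬ (w p.1 = k.castSucc ∧ w p.2 = k.succ) → ¬ (w p.1 = k.succ ∧ w p.2 = k.castSucc) →
      ((if IsCoverPair w p ∧ LeftDescent k (w * swap p.1 p.2) then
          (1 + 2 * bQ w p.1 p.2 : ℚ) * f (adjTransp k * (w * swap p.1 p.2)) else 0) -
        (if LeftDescent k w ∧ IsCoverPair (adjTransp k * w) p then
          (1 + 2 * bQ (adjTransp k * w) p.1 p.2 : ℚ) * f (adjTransp k * w * swap p.1 p.2) else 0))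
        = 0 := by
    rintro ⟨i, j⟩ h₁ h₂
    have hiff := isCoverPair_and_leftDescent_iff h₁ h₂
    by_cases h : IsCoverPair w (i, j) ∧ LeftDescent k (w * swap i j)
    · have h' := hiff.mp h
      rw [if_pos h, if_pos h', mul_assoc, bQ_adjTransp_mul h'.1 h.2, sub_self]
    · rw [if_neg h, if_neg (hiff.not.mp h), sub_self]
  by_cases hk : LeftDescent k w
  · have hlt : w⁻¹ k.succ < w⁻¹ k.castSucc := hk
    have heq : adjTransp k * w = w * swap (w⁻¹ k.succ) (w⁻¹ k.castSucc) :=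
      adjTransp_mul_eq_mul_swap (by simp)
    have hlen := invCount_eq_adjTransp_mul_add_one hk
    rw [Finset.sum_eq_single (w⁻¹ k.succ, w⁻¹ k.castSucc)]
    · have hnot : ¬ IsCoverPair w (w⁻¹ k.succ, w⁻¹ k.castSucc) := by
        rintro ⟨-, h⟩
        dsimp only at h
        rw [← heq] at h
        omega
      have hcov : IsCoverPair (adjTransp k * w) (w⁻¹ k.succ, w⁻¹ k.castSucc) := by
        refine ⟨hlt, ?_⟩
        dsimp only
        rwa [mul_assoc, ← heq, adjTransp_mul_cancel]
      rw [if_neg fun h => hnot h.1, if_pos ⟨hk, hcov⟩, leftInv_castSucc_eq_add_bQ hk, mul_assoc,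
        ← heq, adjTransp_mul_cancel]
      push_cast
      ring
    · rintro ⟨i, j⟩ - hp
      by_cases h₁ : w i = k.castSucc ∧ w j = k.succ
      · have hji : ¬ i < j := not_lt.mpr (hk.lt_of_apply h₁.2 h₁.1).le
        rw [if_neg fun h => hji h.1.1, if_neg fun h => hji h.2.1, sub_self]
      · refine hgen _ h₁ fun h₂ => hp ?_
        rw [← h₂.1, ← h₂.2]
        simp
    · simp
  · have hlt : w⁻¹ k.castSucc < w⁻¹ k.succ :=
      lt_of_le_of_ne (not_lt.mp hk) (by simp [Fin.ext_iff])
    have heq : adjTransp k * w = w * swap (w⁻¹ k.castSucc) (w⁻¹ k.succ) :=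
      adjTransp_mul_eq_mul_swap (by simp)
    have hlen := invCount_adjTransp_mul hk
    rw [Finset.sum_eq_single (w⁻¹ k.castSucc, w⁻¹ k.succ)]
    · have hcov : IsCoverPair w (w⁻¹ k.castSucc, w⁻¹ k.succ) := by
        refine ⟨hlt, ?_⟩
        dsimp only
        rwa [← heq]
      have hdesc : LeftDescent k (w * swap (w⁻¹ k.castSucc) (w⁻¹ k.succ)) := by
        rwa [← heq, leftDescent_adjTransp_mul]
      rw [if_pos ⟨hcov, hdesc⟩, if_neg fun h => hk h.1, leftInv_succ_eq_add_bQ hk,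
        ← heq, adjTransp_mul_cancel]
      push_cast
      ring
    · rintro ⟨i, j⟩ - hp
      by_cases h₂ : w i = k.succ ∧ w j = k.castSucc
      · have hji : ¬ i < j := by
          have hi : i = w⁻¹ k.succ := Perm.eq_inv_iff_eq.mpr h₂.1
          have hj : j = w⁻¹ k.castSucc := Perm.eq_inv_iff_eq.mpr h₂.2
          rw [hi, hj]
          exact not_lt.mpr hlt.le
        rw [if_neg fun h => hji h.1.1, if_neg fun h => hji h.2.1, sub_self]
      · refine hgen _ (fun h₁ => hp ?_) h₂
        rw [← h₁.1, ← h₁.2]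
        simp
    · simp

lemma sum_mul_leftInv_sub (w : Perm (Fin (n + 1))) :
    ∑ k : Fin n, ((k : ℕ) + 1 : ℚ) *
        (1 + 2 * ((leftInv w (w⁻¹ k.succ) : ℚ) - leftInv w (w⁻¹ k.castSucc))) =
      (n * (n + 1) / 2 : ℚ) - 2 * invCount w := by
  have hlast : leftInv w (w⁻¹ (Fin.last n)) = 0 := by
    simp [leftInv, Fin.le_last]
  have hsum : ∑ v, (leftInv w (w⁻¹ v) : ℚ) = invCount w := by
    rw [Equiv.sum_comp w⁻¹ fun y => (leftInv w y : ℚ)]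
    exact_mod_cast sum_leftInv w
  have habel := sum_mul_sub_eq fun v => (leftInv w (w⁻¹ v) : ℚ)
  rw [hlast, hsum] at habel
  have hgauss : ∑ k : Fin n, ((k : ℕ) + 1 : ℚ) = n * (n + 1) / 2 := by
    rw [Fin.sum_univ_eq_sum_range fun k => (k + 1 : ℚ)]
    clear * -
    induction n with
    | zero => simp
    | succ n ih =>
      rw [Finset.sum_range_succ, ih]
      push_cast
      ring
  simp only [mul_add, mul_one, Finset.sum_add_distrib, hgauss]
  simp only [mul_left_comm _ (2 : ℚ), ← Finset.mul_sum, habel]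
  push_cast
  ring

/-- The raising operator with weights `1 + 2 b` acts on principal specializations by a scalar. -/
lemma sum_cover_one_add_two_bQ (w : Perm (Fin (n + 1))) :
    ∑ p, (if IsCoverPair w p then (1 + 2 * bQ w p.1 p.2 : ℚ) * prinSpec (w * swap p.1 p.2) else 0) =
      ((n * (n + 1) / 2 : ℚ) - invCount w) * prinSpec w := by
  induction hL : invCount w using Nat.strong_induction_on generalizing w with
  | _ L ih =>
    subst hL
    have hraise : (invCount w + 1 : ℚ) *
        ∑ p, (if IsCoverPair w p then
          (1 + 2 * bQ w p.1 p.2 : ℚ) * prinSpec (w * swap p.1 p.2) else 0) =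
        ∑ k : Fin n, ((k : ℕ) + 1 : ℚ) * ∑ p,
          (if IsCoverPair w p ∧ LeftDescent k (w * swap p.1 p.2) then
            (1 + 2 * bQ w p.1 p.2 : ℚ) * prinSpec (adjTransp k * (w * swap p.1 p.2)) else 0) := by
      simp only [Finset.mul_sum]
      rw [Finset.sum_comm]
      refine Finset.sum_congr rfl fun p _ => ?_
      by_cases hp : IsCoverPair w p
      · have h := invCount_mul_prinSpec (w * swap p.1 p.2)
        rw [hp.2] at h
        push_cast at h
        simp only [hp, if_true, true_and]
        rw [mul_left_comm, h, Finset.mul_sum]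
        refine Finset.sum_congr rfl fun k _ => ?_
        split_ifs <;> ring
      · simp [hp]
    have hlower : ∀ k : Fin n, (∑ p, if LeftDescent k w ∧ IsCoverPair (adjTransp k * w) p then
          (1 + 2 * bQ (adjTransp k * w) p.1 p.2 : ℚ) * prinSpec (adjTransp k * w * swap p.1 p.2)
          else 0) =
        ((n * (n + 1) / 2 : ℚ) - invCount w + 1) *
          (if LeftDescent k w then prinSpec (adjTransp k * w) else 0) := by
      intro k
      by_cases hk : LeftDescent k w
      · have hlen := invCount_eq_adjTransp_mul_add_one hk
        simp only [hk, true_and, if_true]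
        rw [ih _ (by omega) _ rfl, hlen]
        push_cast
        ring
      · simp [hk]
    have hpos : (invCount w + 1 : ℚ) ≠ 0 := by positivity
    apply mul_left_cancel₀ hpos
    have hdiff := Finset.sum_congr (rfl : (univ : Finset (Fin n)) = univ) fun k _ =>
      congrArg (((k : ℕ) + 1 : ℚ) * ·) (sum_cover_sub_cover k w prinSpec)
    simp only [Finset.sum_sub_distrib, mul_sub (_ + 1 : ℚ) (∑ _, _) _, ← hraise, hlower,
      ← mul_assoc (_ + 1 : ℚ) (1 + _) _, ← Finset.sum_mul, sum_mul_leftInv_sub] at hdiff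
    have hrec : ∑ k : Fin n, ((k : ℕ) + 1 : ℚ) * (((n * (n + 1) / 2 : ℚ) - invCount w + 1) *
        (if LeftDescent k w then prinSpec (adjTransp k * w) else 0)) =
        ((n * (n + 1) / 2 : ℚ) - invCount w + 1) * (invCount w * prinSpec w) := by
      rw [invCount_mul_prinSpec, Finset.mul_sum]
      refine Finset.sum_congr rfl fun k _ => ?_
      split_ifs <;> ring
    rw [hrec] at hdiff
    linear_combination hdiff

lemma swap_apply_eq_inv (w : Perm (Fin n)) (i j : Fin n) :
    w⁻¹ * swap (w i) (w j) = (w * swap i j)⁻¹ := by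
  rw [swap_apply_apply]
  simp [mul_assoc]

lemma IsCoverPair.inv {w : Perm (Fin n)} {p : Fin n × Fin n} (h : IsCoverPair w p) :
    IsCoverPair w⁻¹ (w p.1, w p.2) := by
  refine ⟨lt_of_invCount_lt_mul_swap h.1 (by rw [h.2]; omega), ?_⟩
  rw [swap_apply_eq_inv, invCount_inv, invCount_inv, h.2]

lemma cQ_eq_bQ_inv (w : Perm (Fin n)) (i j : Fin n) : cQ w i j = bQ w⁻¹ (w i) (w j) := by
  unfold cQ bQ
  refine Finset.card_bij' (fun x _ => w x) (fun y _ => w⁻¹ y) ?_ ?_ ?_ ?_ <;>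
    simp +contextual

lemma sum_cover_one_add_two_cQ (w : Perm (Fin (n + 1))) :
    ∑ p ∈ univ.filter (IsCoverPair w), (1 + 2 * cQ w p.1 p.2 : ℚ) * prinSpec (w * swap p.1 p.2) =
      ((n * (n + 1) / 2 : ℚ) - invCount w) * prinSpec w := by
  rw [← invCount_inv w, ← prinSpec_inv w, ← sum_cover_one_add_two_bQ, ← Finset.sum_filter]
  refine Finset.sum_bij' (fun p _ => (w p.1, w p.2)) (fun p _ => (w⁻¹ p.1, w⁻¹ p.2)) ?_ ?_ ?_ ?_ ?_
  · intro p hp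
    simpa using (mem_filter.mp hp).2.inv
  · intro p hp
    simpa using (mem_filter.mp hp).2.inv
  · simp
  · simp
  · intro p _
    rw [swap_apply_eq_inv, prinSpec_inv, cQ_eq_bQ_inv]

end BruhatCoverSum

theorem sum_b_sub_c_eq_zero {n : ℕ} (w : Equiv.Perm (Fin (n + 1))) :
    ∑ p ∈ Finset.univ.filter
        (fun p : Fin (n + 1) × Fin (n + 1) =>
          p.1 < p.2 ∧ invCount (w * Equiv.swap p.1 p.2) = invCount w + 1),
      prinSpec (w * Equiv.swap p.1 p.2) *
        ((bQ w p.1 p.2 : ℚ) - (cQ w p.1 p.2 : ℚ)) = 0 := by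
  have hb := sum_cover_one_add_two_bQ w
  rw [← Finset.sum_filter, ← sum_cover_one_add_two_cQ w, ← sub_eq_zero,
    ← Finset.sum_sub_distrib] at hb
  have h : (2 : ℚ) * ∑ p ∈ univ.filter (IsCoverPair w), prinSpec (w * swap p.1 p.2) *
      ((bQ w p.1 p.2 : ℚ) - (cQ w p.1 p.2 : ℚ)) = 0 := by
    rw [← hb, Finset.mul_sum]
    exact Finset.sum_congr rfl fun p _ => by ring
  have h' := (mul_eq_zero.mp h).resolve_left two_ne_zero
  rw [← h']
  refine Finset.sum_congr ?_ fun _ _ => rfl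
  ext p
  simp [IsCoverPair]
end
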